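/- Let FH be a Frobenius group with kernel F and complement H acting on a finite q-group Q for some prime q coprime to |FH|. Let V be a kQFH-module, where k is a field whose characteristic does not divide |QFH|. If C_V(F) = 0, then the kernel of the action of C_Q(H) on C_V(H) equals the kernel of the action of C_Q(H) on V. -/

import Mathlib

/-- Abelian step of the conjugacy part of Schur-Zassenhaus. -/
theorem conj_step {T : Type*} [Group T] [Finite T] (N S S' : Subgroup T)
    (hS : ∀ s ∈ S, ∀ n ∈ N, s * n * s⁻¹ ∈ N)
    (hNS : ∀ t, t ∈ N → t ∈ S → t = 1)
    (hcop : (Nat.card N).Coprime (Nat.card S'))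
    (hsub : ∀ a ∈ S', ∃ s ∈ S, a * s⁻¹ ∈ N) :
    ∃ n ∈ N, ∀ a ∈ S', ∃ s ∈ S, ∃ h : n * a * n⁻¹ * s⁻¹ ∈ N,
      (⟨n * a * n⁻¹ * s⁻¹, h⟩ : N) ∈ commutator N := by
  classical
  have : Fintype S' := Fintype.ofFinite S'
  choose! σ hσS hσN using hsub
  let c : T → (N →* N) := fun s => if h : s ∈ S then
    MonoidHom.mk' (fun n => ⟨s * n * s⁻¹, hS s h n n.2⟩) (by intro a b; ext; simp) else 1
  have hc : ∀ s ∈ S, ∀ n : N, ((c s n : N) : T) = s * n * s⁻¹ := by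
    intro s hs n; simp [c, hs]
  let d : S' → N := fun a => ⟨a * (σ a)⁻¹, hσN a a.2⟩
  have hσm : ∀ a b : S', σ ((a * b : S') : T) = σ a * σ b := by
    intro a b
    have h1 := hσN _ (a * b).2
    have h2 : (a * b : T) * (σ a * σ b)⁻¹ ∈ N := by
      have := N.mul_mem (hσN _ a.2) (hS _ (hσS _ a.2) _ (hσN _ b.2))
      convert this using 1; group
    have h3 := hNS (σ ((a * b : S') : T) * (σ a * σ b)⁻¹)
      (by convert N.mul_mem (N.inv_mem h1) h2 using 1; simp; group)
      (S.mul_mem (hσS _ (a*b).2) (S.inv_mem (S.mul_mem (hσS _ a.2) (hσS _ b.2))))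
    exact mul_inv_eq_one.mp h3
  have hd : ∀ a b : S', d (a * b) = d a * c (σ a) (d b) := by
    intro a b
    ext
    simp only [d, Subgroup.coe_mul, hc _ (hσS _ a.2)]
    have := hσm a b
    simp only [Subgroup.coe_mul] at this
    rw [this]; group
  let ab : N →* Abelianization N := Abelianization.of
  let th : T → (Abelianization N →* Abelianization N) := fun s => Abelianization.map (c s)
  have hth : ∀ s n, th s (ab n) = ab (c s n) := fun s n => Abelianization.map_of _ _
  let m : Abelianization N := ∏ b : S', ab (d b)
  have hm : ∀ a : S', m = ab (d a) ^ (Nat.card S') * th (σ a) m := by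
    intro a
    have : m = ∏ b : S', ab (d (a * b)) :=
      (Fintype.prod_equiv (Equiv.mulLeft a) _ _ (fun b => rfl)).symm
    have h2 : th (σ a) m = ∏ b : S', ab (c (σ a) (d b)) := by simp only [m, map_prod, hth]
    rw [h2, this]
    simp only [hd, map_mul, Finset.prod_mul_distrib]
    simp [Nat.card_eq_fintype_card]
  obtain ⟨l, hl⟩ : ∃ l : ℕ, ∀ y : Abelianization N, (y ^ (Nat.card S')) ^ l = y := by
    obtain ⟨z, hz1, hz0⟩ := Nat.chineseRemainder hcop 1 0
    obtain ⟨l, rfl⟩ := (Nat.modEq_zero_iff_dvd.mp hz0)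
    refine ⟨l, fun y => ?_⟩
    obtain ⟨n, rfl⟩ : ∃ n : N, ab n = y := QuotientGroup.mk_surjective _
    rw [← pow_mul, ← map_pow]
    congr 1
    conv_rhs => rw [← pow_one n]
    exact pow_eq_pow_iff_modEq.mpr (hz1.of_dvd (orderOf_dvd_natCard n))
  obtain ⟨n, hn⟩ : ∃ n : N, ab n = (m⁻¹) ^ l := QuotientGroup.mk_surjective _
  refine ⟨n, n.2, fun a ha => ⟨σ a, hσS _ ha, ?_⟩⟩
  have key : n * d ⟨a, ha⟩ * (c (σ a) n)⁻¹ ∈ commutator N := by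
    have : ab (n * d ⟨a, ha⟩ * (c (σ a) n)⁻¹) = 1 := by
      rw [map_mul, map_mul, map_inv, ← hth, hn, map_pow, map_inv]
      have h1 := hm ⟨a, ha⟩
      have h2 : ab (d ⟨a, ha⟩) = (m * (th (σ a) m)⁻¹) ^ l := by
        rw [← hl (ab (d ⟨a, ha⟩))]; congr 1
        rw [eq_mul_inv_iff_mul_eq]; exact h1.symm
      rw [h2, mul_pow, inv_pow, inv_pow]
      simp
    exact (QuotientGroup.eq_one_iff _).mp this
  have e : (n : T) * a * (n : T)⁻¹ * (σ a)⁻¹ = (n * d ⟨a, ha⟩ * (c (σ a) n)⁻¹ : N) := by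
    simp only [Subgroup.coe_mul, Subgroup.coe_inv, hc _ (hσS _ ha), d]
    group
  refine ⟨e ▸ SetLike.coe_mem _, ?_⟩
  convert key
  
theorem conj_compl {T : Type*} [Group T] [Finite T] {q : ℕ} (hq : q.Prime) (k : ℕ) :
    ∀ (N S S' : Subgroup T) (_ : Nat.card N ≤ k) (_ : IsPGroup q N)
    (_ : ∀ s ∈ S, ∀ n ∈ N, s * n * s⁻¹ ∈ N)
    (_ : q.Coprime (Nat.card S)) (_ : q.Coprime (Nat.card S'))
    (_ : ∀ a ∈ S', ∃ s ∈ S, a * s⁻¹ ∈ N),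
    ∃ n ∈ N, ∀ a ∈ S', n * a * n⁻¹ ∈ S := by
  classical
  have := Fact.mk hq
  induction k with
  | zero => intro N S S' h; exact absurd h (by simpa using Nat.card_pos.ne')
  | succ k ih =>
    intro N S S' hk hN hS hcS hcS' hsub
    by_cases hbot : N = ⊥
    · subst hbot
      refine ⟨1, by simp, fun a ha => ?_⟩
      obtain ⟨s, hs, h⟩ := hsub a ha
      rw [Subgroup.mem_bot, mul_inv_eq_one] at h
      simpa [h] using hs
    obtain ⟨r, hr⟩ := IsPGroup.iff_card.mp hN
    have hNS : ∀ t, t ∈ N → t ∈ S → t = 1 := by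
      intro t h1 h2
      have := Subgroup.disjoint_of_coprime_natCard (H := N) (K := S)
        (by rw [hr]; exact hcS.pow_left r)
      exact Subgroup.mem_bot.mp (this.eq_bot ▸ (⟨h1, h2⟩ : t ∈ N ⊓ S))
    obtain ⟨n, hn, hna⟩ := conj_step N S S' hS hNS (by rw [hr]; exact hcS'.pow_left r) hsub
    let N1 : Subgroup T := (commutator N).map N.subtype
    have hN1 : N1 ≤ N := Subgroup.map_subtype_le _
    have : Nontrivial N := N.nontrivial_iff_ne_bot.mpr hbot
    have hlt : N1 < N := by
      refine lt_of_le_of_ne hN1 fun h => ?_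
      have : Group.IsNilpotent N := hN.isNilpotent
      have h2 : commutator N = ⊤ := by
        apply Subgroup.map_injective N.subtype_injective
        rw [← MonoidHom.range_eq_map, Subgroup.range_subtype]; exact h
      exact (Group.IsSolvable.commutator_lt_top_of_nontrivial N).ne h2
    have hcard : Nat.card N1 ≤ k := by
      have := Set.ncard_lt_ncard (s := (N1 : Set T)) (t := N) hlt
      have e1 : Nat.card N1 = (N1 : Set T).ncard := rfl
      have e2 : Nat.card N = (N : Set T).ncard := rfl
      omega
    have g1 : ∀ s ∈ S, ∀ y ∈ N1, s * y * s⁻¹ ∈ N1 := by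
      intro s hs y hy
      let c : N →* N := MonoidHom.mk' (fun n => ⟨s * n * s⁻¹, hS s hs n n.2⟩)
        (by intro a b; ext; simp)
      obtain ⟨z, hz, rfl⟩ := hy
      refine ⟨c z, ?_, rfl⟩
      have : (commutator N).map c ≤ commutator N := by
        rw [commutator_def, Subgroup.map_commutator]
        exact Subgroup.commutator_mono le_top le_top
      exact this ⟨z, hz, rfl⟩
    have g2 : q.Coprime (Nat.card (S'.map (MulAut.conj n).toMonoidHom)) := by
      have e := (Subgroup.equivMapOfInjective S' (MulAut.conj n).toMonoidHom
        (MulAut.conj n).injective).toEquiv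
      rwa [← Nat.card_congr e]
    have g3 : ∀ a ∈ S'.map (MulAut.conj n).toMonoidHom, ∃ s ∈ S, a * s⁻¹ ∈ N1 := by
      rintro _ ⟨a, ha, rfl⟩
      obtain ⟨s, hs, h, h'⟩ := hna a ha
      exact ⟨s, hs, ⟨_, h', rfl⟩⟩
    obtain ⟨u, hu, hua⟩ := ih N1 S (S'.map (MulAut.conj n).toMonoidHom) hcard
      (hN.to_le hN1) g1 hcS g2 g3
    refine ⟨u * n, N.mul_mem (hN1 hu) hn, fun a ha => ?_⟩
    have := hua (n * a * n⁻¹) ⟨a, ha, rfl⟩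
    convert this using 1; group

open Classical in
/-- The sum of the elements of a subgroup in an algebra. -/
noncomputable def sg {T E : Type*} [Group T] [Fintype T] [Ring E] (ρ : T →* E)
    (A : Subgroup T) : E := ∑ t : T, if t ∈ A then ρ t else 0

/-- `π` is the projection on a block of imprimitivity with stabilizer `S`. -/
structure Block {T E : Type*} [Group T] [Ring E] (ρ : T →* E) (S : Subgroup T) (π : E) : Prop where
  idem : π * π = π
  comm : ∀ s ∈ S, ρ s * π = π * ρ s
  off : ∀ g, g ∉ S → π * ρ g * π = 0

theorem sg_eq {T E : Type*} [Group T] [Fintype T] [Ring E] (ρ : T →* E)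
    (A : Subgroup T) [Fintype A] : sg ρ A = ∑ t : A, ρ t := by
  classical
  rw [sg, ← Finset.sum_filter]
  exact Finset.sum_subtype _ (by simp) _

theorem Block.sandwich {T E : Type*} [Group T] [Fintype T] [Ring E] {ρ : T →* E}
    {S : Subgroup T} {π : E} (hb : Block ρ S π) {g : T} (hg : g ∈ S) :
    π * ρ g * π = ρ g * π := by
  rw [← hb.comm g hg, mul_assoc, hb.idem]

theorem rho_inv {T E : Type*} [Group T] [Ring E] (ρ : T →* E) (g : T) : ρ g⁻¹ * ρ g = 1 := by
  rw [← map_mul]; simp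

theorem rho_inv' {T E : Type*} [Group T] [Ring E] (ρ : T →* E) (g : T) : ρ g * ρ g⁻¹ = 1 := by
  rw [← map_mul]; simp

/-- The sum over a fixed-point-free `F` controls the sum over `H`. -/
theorem frob_sum {T E K : Type*} [Group T] [Fintype T] [Field K] [Ring E] [Algebra K E]
    (ρ : T →* E) (hT : (Nat.card T : K) ≠ 0) (S F H : Subgroup T) (π : E)
    (hb : Block ρ S π) (hFS : F ≤ S) (hHS : H ≤ S)
    (hn : ∀ h ∈ H, ∀ f ∈ F, h * f * h⁻¹ ∈ F)
    (hfrob : ∀ h ∈ H, h ≠ 1 → ∀ f ∈ F, h * f * h⁻¹ = f → f = 1)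
    (hF : sg ρ F * π = 0) (hH : sg ρ H * π = 0) : π = 0 := by
  classical
  have := Fintype.ofFinite F
  have := Fintype.ofFinite H
  have h1 : ∑ h : H, ∑ f : F, ρ (f * h * (f : T)⁻¹) * π = 0 := by
    rw [Finset.sum_comm]
    refine Finset.sum_eq_zero fun f _ => ?_
    have : ∑ h : H, ρ (f * h * (f : T)⁻¹) * π = ρ f * (sg ρ H * π) * ρ (f : T)⁻¹ := by
      rw [sg_eq, Finset.sum_mul, Finset.mul_sum, Finset.sum_mul]
      refine Finset.sum_congr rfl fun h _ => ?_
      rw [map_mul, map_mul, mul_assoc (ρ f * ρ h), hb.comm _ (S.inv_mem (hFS f.2))]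
      simp only [mul_assoc]
    rw [this, hH]; simp
  have h2 : ∀ h : H, h ≠ 1 → ∑ f : F, ρ (f * h * (f : T)⁻¹) * π = 0 := by
    intro h hh
    let e : F → F := fun f => f * ⟨h * (f : T)⁻¹ * (h : T)⁻¹, hn h h.2 _ (F.inv_mem f.2)⟩
    have he : Function.Injective e := by
      intro a b hab
      have hab' : (a : T) * (h * (a : T)⁻¹ * (h : T)⁻¹) = b * (h * (b : T)⁻¹ * (h : T)⁻¹) :=
        congrArg Subtype.val hab
      have := hfrob h h.2 (by simpa using hh) ((b : T)⁻¹ * a) (F.mul_mem (F.inv_mem b.2) a.2) (by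
        have e1 : (b : T)⁻¹ * (a * (h * (a : T)⁻¹ * (h : T)⁻¹)) * (h * a * (h : T)⁻¹) =
          (b : T)⁻¹ * a := by group
        rw [hab'] at e1
        refine Eq.trans ?_ e1; group)
      exact Subtype.ext (inv_mul_eq_one.mp this).symm
    have hbij : Function.Bijective e := Finite.injective_iff_bijective.mp he
    have : ∑ f : F, ρ (f * h * (f : T)⁻¹) * π = (sg ρ F * π) * ρ h := by
      rw [sg_eq, Finset.sum_mul, Finset.sum_mul,
        ← Function.Bijective.sum_comp hbij (fun f : F => ρ f * π * ρ h)]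
      refine Finset.sum_congr rfl fun f _ => ?_
      rw [mul_assoc (ρ (e f : T)) π, ← hb.comm _ (hHS h.2), ← mul_assoc, ← map_mul]
      congr 2
      simp only [e, Subgroup.coe_mul]; group
    rw [this, hF, zero_mul]
  rw [Finset.sum_eq_single 1 (fun h _ hh => h2 h hh) (by simp)] at h1
  simp only [Subgroup.coe_one, mul_one, mul_inv_cancel, map_one, one_mul, Finset.sum_const,
    Finset.card_univ, ← Nat.card_eq_fintype_card] at h1
  have h3 : (Nat.card F : K) ≠ 0 := by
    intro h
    obtain ⟨c, hc⟩ := Subgroup.card_subgroup_dvd_card F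
    apply hT; rw [hc]; push_cast; rw [h, zero_mul]
  rw [← Nat.cast_smul_eq_nsmul K] at h1
  exact (smul_eq_zero.mp h1).resolve_left h3

theorem block_fix {T E K : Type*} [Group T] [Fintype T] [Field K] [Ring E] [Algebra K E]
    (ρ : T →* E) (hT : (Nat.card T : K) ≠ 0)
    (Q F H : Subgroup T) (q : ℕ) (hq : q.Prime)
    (hQn : Q.Normal) (hQp : IsPGroup q Q)
    (hFH_norm : ∀ h ∈ H, ∀ f ∈ F, h * f * h⁻¹ ∈ F)
    (hfrob : ∀ h ∈ H, h ≠ 1 → ∀ f ∈ F, h * f * h⁻¹ = f → f = 1)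
    (hgen : Q ⊔ F ⊔ H = ⊤)
    (hcop : Nat.Coprime q (Nat.card ↥(F ⊔ H)))
    (hF : sg ρ F = 0) (S : Subgroup T) (π : E) (hb : Block ρ S π)
    (hH : sg ρ (H ⊓ S) * π = 0) : π = 0 := by
  classical
  have := Fact.mk hq
  have hcF : q.Coprime (Nat.card F) :=
    hcop.coprime_dvd_right (Subgroup.card_dvd_of_le le_sup_left)
  have hcH : q.Coprime (Nat.card (H ⊓ S : Subgroup T)) :=
    hcop.coprime_dvd_right (Subgroup.card_dvd_of_le (inf_le_left.trans le_sup_right))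
  have hQF : ∀ t, t ∈ Q → t ∈ F → t = 1 := by
    intro t h1 h2
    obtain ⟨r, hr⟩ := IsPGroup.iff_card.mp hQp
    have := Subgroup.disjoint_of_coprime_natCard (H := Q) (K := F)
        (by rw [hr]; exact hcF.pow_left r)
    exact Subgroup.mem_bot.mp (this.eq_bot ▸ (⟨h1, h2⟩ : t ∈ Q ⊓ F))
  have hidx : q.Coprime Q.index := by
    have e : Q.index = Q.relIndex (F ⊔ H) := by
      rw [← Subgroup.relIndex_sup_right, ← Subgroup.relIndex_top_right, sup_comm, ← sup_assoc, hgen]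
    rw [e]
    exact hcop.coprime_dvd_right (Subgroup.relIndex_dvd_card _ _)
  have hPp : IsPGroup q (Q ⊓ S : Subgroup T) := hQp.to_le inf_le_left
  -- a complement of `Q ⊓ S` in `S`
  obtain ⟨L, hLS, hLc, hLd⟩ : ∃ L : Subgroup T, L ≤ S ∧ q.Coprime (Nat.card L) ∧
      ∀ s ∈ S, ∃ p ∈ Q ⊓ S, ∃ l ∈ L, p * l = s := by
    have hco : q.Coprime (Q.subgroupOf S).index :=
      hidx.coprime_dvd_right (Subgroup.relIndex_dvd_index_of_normal Q S)
    have hp : IsPGroup q (Q.subgroupOf S) := hQp.comap_subtype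
    obtain ⟨r, hr⟩ := IsPGroup.iff_card.mp hp
    obtain ⟨L, hL⟩ := Subgroup.exists_right_complement'_of_coprime (N := Q.subgroupOf S)
      (by rw [hr]; exact hco.pow_left r)
    refine ⟨L.map S.subtype, Subgroup.map_subtype_le _, ?_, ?_⟩
    · rw [← Nat.card_congr (Subgroup.equivMapOfInjective L S.subtype S.subtype_injective).toEquiv]
      rwa [← hL.symm.index_eq_card]
    · intro s hs
      obtain ⟨⟨a, b⟩, hab⟩ := hL.2 ⟨s, hs⟩
      exact ⟨a, ⟨a.2, a.1.2⟩, b, ⟨b, b.2, rfl⟩, congrArg Subtype.val hab⟩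
  -- move it so that it contains `H ⊓ S`
  obtain ⟨n, hn, hnH⟩ := conj_compl hq _ (Q ⊓ S) L (H ⊓ S) le_rfl hPp
    (fun s hs n hn => ⟨hQn.conj_mem _ hn.1 s, S.mul_mem (S.mul_mem (hLS hs) hn.2)
      (S.inv_mem (hLS hs))⟩) hLc hcH
    (fun a ha => by
      obtain ⟨p, hp, l, hl, rfl⟩ := hLd a ha.2
      exact ⟨l, hl, by simpa using hp⟩)
  -- work with the conjugated complement through `n`
  let M : Subgroup T := L.comap (MulAut.conj n).toMonoidHom
  have hM : ∀ t, t ∈ M ↔ n * t * n⁻¹ ∈ L := fun t => Iff.rfl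
  have hMS : M ≤ S := by
    intro t ht
    have := S.mul_mem (S.mul_mem (S.inv_mem hn.2) (hLS ((hM t).1 ht))) hn.2
    convert this using 1; group
  have hMc : q.Coprime (Nat.card M) := by
    have : Nat.card M ∣ Nat.card L := by
      apply Subgroup.card_dvd_of_injective ((MulAut.conj n).toMonoidHom.subgroupComap L)
      intro a b hab
      have := congrArg Subtype.val hab
      exact Subtype.ext ((MulAut.conj n).injective this)
    exact hLc.coprime_dvd_right this
  have hMd : ∀ s ∈ S, ∃ p ∈ Q ⊓ S, ∃ l ∈ M, p * l = s := by
    intro s hs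
    obtain ⟨p, hp, l, hl, h⟩ := hLd (n * s * n⁻¹) (S.mul_mem (S.mul_mem hn.2 hs) (S.inv_mem hn.2))
    refine ⟨n⁻¹ * p * n, ⟨by simpa using hQn.conj_mem _ hp.1 n⁻¹,
      S.mul_mem (S.mul_mem (S.inv_mem hn.2) hp.2) hn.2⟩, n⁻¹ * l * n, ?_, ?_⟩
    · rw [hM]; convert hl using 1; group
    · have : n⁻¹ * (p * l) * n = s := by rw [h]; group
      rw [← this]; group
  have hHM : H ⊓ S ≤ M := fun h hh => (hM h).2 (hnH h hh)
  let F1 : Subgroup T := M ⊓ (Q ⊔ F)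
  have hF1S : F1 ≤ S := inf_le_left.trans hMS
  have hQFn : ∀ h ∈ H, ∀ f ∈ Q ⊔ F, h * f * h⁻¹ ∈ Q ⊔ F := by
    intro h hh f hf
    obtain ⟨a, ha, b, hb, rfl⟩ := Subgroup.mem_sup_of_normal_left.mp hf
    have := (Q ⊔ F).mul_mem (Subgroup.mem_sup_left (hQn.conj_mem a ha h))
      (Subgroup.mem_sup_right (hFH_norm h hh b hb))
    convert this using 1; group
  -- conjugate `F1` into `F`
  obtain ⟨u, hu, huF⟩ := conj_compl hq _ Q F F1 le_rfl hQp (fun s _ n hn => hQn.conj_mem n hn s) hcF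
    (hMc.coprime_dvd_right (Subgroup.card_dvd_of_le inf_le_left))
    (fun a ha => by
      obtain ⟨p, hp, l, hl, rfl⟩ := Subgroup.mem_sup_of_normal_left.mp ha.2
      exact ⟨l, hl, by simpa using hp⟩)
  have hF1 : sg ρ F1 * π = 0 := by
    have e1 : π * ρ u⁻¹ * sg ρ F * ρ u * π = 0 := by rw [hF]; simp
    have e2 : π * ρ u⁻¹ * sg ρ F * ρ u * π =
        ∑ t : T, if u * t * u⁻¹ ∈ F then π * ρ t * π else 0 := by
      rw [sg, ← Equiv.sum_comp (MulAut.conj u).toEquiv, Finset.mul_sum, Finset.sum_mul,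
        Finset.sum_mul]
      refine Finset.sum_congr rfl fun t _ => ?_
      have e : (MulAut.conj u).toEquiv t = u * t * u⁻¹ := rfl
      rw [e]
      by_cases h : u * t * u⁻¹ ∈ F
      · rw [if_pos h, if_pos h, mul_assoc π, mul_assoc π, ← map_mul, ← map_mul]
        congr 3; group
      · rw [if_neg h, if_neg h]; simp
    rw [← e1, e2, sg, Finset.sum_mul]
    refine Finset.sum_congr rfl fun t _ => ?_
    by_cases ht : t ∈ F1
    · rw [if_pos ht, if_pos (huF t ht), hb.sandwich (hF1S ht)]
    · rw [if_neg ht]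
      split_ifs with h
      · by_cases hts : t ∈ S
        · exfalso
          apply ht
          obtain ⟨p, hp, l, hl, rfl⟩ := hMd t hts
          have hlF : l ∈ F1 := by
            refine ⟨hl, ?_⟩
            have : l = (p⁻¹ * u⁻¹) * (u * (p * l) * u⁻¹) * u := by group
            rw [this]
            exact (Q ⊔ F).mul_mem ((Q ⊔ F).mul_mem (Subgroup.mem_sup_left
              (Q.mul_mem (Q.inv_mem hp.1) (Q.inv_mem hu))) (Subgroup.mem_sup_right h))
              (Subgroup.mem_sup_left hu)
          have := hQF (u * p * u⁻¹) (hQn.conj_mem p hp.1 u) (by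
            convert F.mul_mem h (F.inv_mem (huF l hlF)) using 1; group)
          have hp1 : p = 1 := by simpa using this
          simpa [hp1] using hlF
        · rw [hb.off t hts]; simp
      · simp
  refine frob_sum ρ hT S F1 (H ⊓ S) π hb hF1S inf_le_right ?_ ?_ hF1 hH
  · intro h hh f hf
    exact ⟨M.mul_mem (M.mul_mem (hHM hh) hf.1) (M.inv_mem (hHM hh)), hQFn h hh.1 f hf.2⟩
  · intro h hh h1 f hf heq
    have hg := huF f hf
    set g := u * f * u⁻¹ with hgdef
    have hfg : f = u⁻¹ * g * u := by rw [hgdef]; group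
    have h2 : h * g * h⁻¹ * g⁻¹ = 1 := by
      refine hQF _ ?_ (F.mul_mem (hFH_norm h hh.1 g hg) (F.inv_mem hg))
      have e : h * g * h⁻¹ * g⁻¹ = (h * u * h⁻¹) * ((h * f * h⁻¹) * (h * u⁻¹ * h⁻¹ * u) *
          (h * f * h⁻¹)⁻¹) * ((h * f * h⁻¹) * f⁻¹) * u⁻¹ * (u * f * u⁻¹ * g⁻¹) := by
        rw [hgdef]; group
      rw [e, heq, ← hgdef]
      simp only [mul_inv_cancel, mul_one]
      exact Q.mul_mem (Q.mul_mem (hQn.conj_mem u hu h) (hQn.conj_mem _ (Q.mul_mem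
        (hQn.conj_mem _ (Q.inv_mem hu) h) hu) f)) (Q.inv_mem hu)
    have := hfrob h hh.1 h1 g hg (mul_inv_eq_one.mp h2)
    rw [hfg, this]; simp

theorem cast_ne_zero_of_dvd {K : Type*} [Field K] {m n : ℕ} (h : (n : K) ≠ 0) (hd : m ∣ n) :
    (m : K) ≠ 0 := by
  obtain ⟨c, rfl⟩ := hd
  intro h0; apply h; push_cast; rw [h0, zero_mul]

/-- `c` restricts to a linear character of `A`. -/
structure IsChar {T K : Type*} [Group T] [Field K] (A : Subgroup T) (c : T → K) : Prop where
  one : c 1 = 1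
  mul : ∀ a ∈ A, ∀ b ∈ A, c (a * b) = c a * c b

open Classical in
/-- The idempotent of a linear character. -/
noncomputable def idem {T E K : Type*} [Group T] [Fintype T] [Field K] [Ring E] [Algebra K E]
    (ρ : T →* E) (A : Subgroup T) (c : T → K) : E :=
  (Nat.card A : K)⁻¹ • ∑ t : A, c (t : T)⁻¹ • ρ t

section
variable {T E K : Type*} [Group T] [Fintype T] [Field K] [Ring E] [Algebra K E]
    {ρ : T →* E} {A : Subgroup T} {c : T → K}

theorem idem_left (hc : IsChar A c) {a : T} (ha : a ∈ A) : ρ a * idem ρ A c = c a • idem ρ A c := by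
  classical
  rw [idem, mul_smul_comm, smul_comm]
  congr 1
  rw [Finset.mul_sum, Finset.smul_sum, ← Equiv.sum_comp (Equiv.mulLeft (⟨a, ha⟩ : A)⁻¹)]
  refine Finset.sum_congr rfl fun t _ => ?_
  simp only [Equiv.coe_mulLeft, Subgroup.coe_mul, Subgroup.coe_inv, mul_inv_rev, inv_inv,
    mul_smul_comm, ← map_mul]
  rw [hc.mul _ (A.inv_mem t.2) _ ha, mul_comm, mul_smul]
  simp

theorem idem_right (hc : IsChar A c) {a : T} (ha : a ∈ A) :
    idem ρ A c * ρ a = c a • idem ρ A c := by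
  classical
  rw [idem, smul_mul_assoc, smul_comm]
  congr 1
  rw [Finset.sum_mul, Finset.smul_sum, ← Equiv.sum_comp (Equiv.mulRight (⟨a, ha⟩ : A)⁻¹)]
  refine Finset.sum_congr rfl fun t _ => ?_
  simp only [Equiv.coe_mulRight, Subgroup.coe_mul, Subgroup.coe_inv, mul_inv_rev, inv_inv,
    smul_mul_assoc, ← map_mul]
  rw [hc.mul _ ha _ (A.inv_mem t.2), mul_smul]
  simp

theorem idem_idem (hT : (Nat.card T : K) ≠ 0) (hc : IsChar A c) :
    idem ρ A c * idem ρ A c = idem ρ A c := by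
  classical
  have hA : (Nat.card A : K) ≠ 0 := cast_ne_zero_of_dvd hT (Subgroup.card_subgroup_dvd_card A)
  conv_lhs => enter [1]; rw [idem]
  rw [smul_mul_assoc, Finset.sum_mul]
  have : ∀ t : A, (c (t : T)⁻¹ • ρ t) * idem ρ A c = idem ρ A c := by
    intro t
    rw [smul_mul_assoc, idem_left hc t.2, smul_smul, ← hc.mul _ (A.inv_mem t.2) _ t.2]
    simp [hc.one]
  rw [Finset.sum_congr rfl fun t _ => this t]
  rw [Finset.sum_const, Finset.card_univ, ← Nat.card_eq_fintype_card, ← Nat.cast_smul_eq_nsmul K,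
    smul_smul, inv_mul_cancel₀ hA, one_smul]

theorem idem_comm {π : E} (h : ∀ a ∈ A, ρ a * π = π * ρ a) :
    idem ρ A c * π = π * idem ρ A c := by
  classical
  rw [idem, smul_mul_assoc, mul_smul_comm, Finset.sum_mul, Finset.mul_sum]
  congr 1
  refine Finset.sum_congr rfl fun t _ => ?_
  rw [smul_mul_assoc, mul_smul_comm, h t t.2]

theorem idem_conj {s : T} (hs : ∀ a, a ∈ A ↔ s * a * s⁻¹ ∈ A)
    (hcs : ∀ a ∈ A, c (s * a * s⁻¹) = c a) : ρ s * idem ρ A c = idem ρ A c * ρ s := by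
  classical
  rw [idem, smul_mul_assoc, mul_smul_comm, Finset.sum_mul, Finset.mul_sum]
  congr 1
  let e : A ≃ A := (MulAut.conj s).toEquiv.subtypeEquiv hs
  rw [← Equiv.sum_comp e (fun t : A => c (t : T)⁻¹ • ρ t * ρ s)]
  refine Finset.sum_congr rfl fun t _ => ?_
  have e1 : ((e t : A) : T) = s * t * s⁻¹ := rfl
  rw [e1, mul_smul_comm, smul_mul_assoc, ← map_mul, ← map_mul]
  have e2 : (s * t * s⁻¹)⁻¹ = s * (t : T)⁻¹ * s⁻¹ := by group
  rw [e2, hcs _ (A.inv_mem t.2)]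
  congr 2; group

/-- stabilizer of a character -/
def stabChar (S A : Subgroup T) (c : T → K) (hn : ∀ s ∈ S, ∀ a ∈ A, s * a * s⁻¹ ∈ A) :
    Subgroup T where
  carrier := {s | s ∈ S ∧ ∀ a ∈ A, c (s * a * s⁻¹) = c a}
  one_mem' := ⟨S.one_mem, by simp⟩
  mul_mem' := by
    rintro s t ⟨hs, hs'⟩ ⟨ht, ht'⟩
    refine ⟨S.mul_mem hs ht, fun a ha => ?_⟩
    rw [← ht' a ha, ← hs' _ (hn t ht a ha)]
    congr 1; group
  inv_mem' := by
    rintro s ⟨hs, hs'⟩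
    refine ⟨S.inv_mem hs, fun a ha => ?_⟩
    rw [← hs' _ (hn _ (S.inv_mem hs) a ha)]
    congr 1; group

theorem block_refine (hT : (Nat.card T : K) ≠ 0) (hc : IsChar A c) {S : Subgroup T} {π : E}
    (hb : Block ρ S π) (hAS : A ≤ S) (hn : ∀ s ∈ S, ∀ a ∈ A, s * a * s⁻¹ ∈ A) :
    Block ρ (stabChar S A c hn) (idem ρ A c * π) := by
  have hcomm : idem ρ A c * π = π * idem ρ A c := idem_comm fun a ha => hb.comm a (hAS ha)
  have hid := idem_idem (ρ := ρ) hT hc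
  refine ⟨?_, ?_, ?_⟩
  · rw [mul_assoc, ← mul_assoc π, ← hcomm, mul_assoc, hb.idem, ← mul_assoc, hid]
  · rintro s ⟨hs, hs'⟩
    rw [← mul_assoc, idem_conj ?_ hs', mul_assoc, hb.comm s hs, mul_assoc]
    intro a
    refine ⟨fun ha => hn s hs a ha, fun ha => ?_⟩
    have := hn _ (S.inv_mem hs) _ ha
    convert this using 1; group
  · intro g hg
    by_cases hgS : g ∈ S
    · have : ∃ a ∈ A, c (g * a * g⁻¹) ≠ c a := by
        by_contra h; push Not at h
        exact hg ⟨hgS, h⟩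
      obtain ⟨a, ha, hne⟩ := this
      have h1 : c a • (idem ρ A c * ρ g * idem ρ A c) =
          c (g * a * g⁻¹) • (idem ρ A c * ρ g * idem ρ A c) := by
        rw [← mul_smul_comm, ← idem_left hc ha, ← smul_mul_assoc, ← smul_mul_assoc,
          ← idem_right hc (hn g hgS a ha), mul_assoc, mul_assoc, ← mul_assoc (ρ g), ← map_mul,
          mul_assoc (idem ρ A c) (ρ (g * a * g⁻¹)), ← mul_assoc (ρ (g * a * g⁻¹)), ← map_mul]
        congr 3
        group
      have h2 : idem ρ A c * ρ g * idem ρ A c = 0 := by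
        rw [← sub_eq_zero, ← sub_smul] at h1
        exact (smul_eq_zero.mp h1).resolve_left (sub_ne_zero.mpr hne.symm)
      calc _ = π * (idem ρ A c * ρ g * idem ρ A c) * π := by
            rw [hcomm]; simp only [mul_assoc]; rw [← hcomm]
        _ = 0 := by rw [h2]; simp
    · calc _ = idem ρ A c * (π * ρ g * π) * idem ρ A c := by
            conv_lhs => enter [2]; rw [hcomm]
            simp only [mul_assoc]
        _ = 0 := by rw [hb.off g hgS]; simp

theorem char_sum [IsSepClosed K] (hT : (Nat.card T : K) ≠ 0) {π y : E}
    (hab : ∀ a ∈ A, ∀ b ∈ A, ρ (a * b * a⁻¹ * b⁻¹) * π = π)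
    (h : ∀ c : T → K, IsChar A c → y * (idem ρ A c * π) = 0) : y * π = 0 := by
  classical
  have hA : (Nat.card A : K) ≠ 0 := cast_ne_zero_of_dvd hT (Subgroup.card_subgroup_dvd_card A)
  have hB : (Nat.card (Abelianization A) : K) ≠ 0 :=
    cast_ne_zero_of_dvd hA (Subgroup.card_quotient_dvd_card _)
  have hX : NeZero ((Monoid.exponent (Abelianization A) : ℕ) : K) :=
    ⟨cast_ne_zero_of_dvd hB Group.exponent_dvd_nat_card⟩
  have hcard := CommGroup.card_monoidHom_of_hasEnoughRootsOfUnity (Abelianization A) K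
  have : Finite (Abelianization A →* Kˣ) :=
    Nat.finite_of_card_ne_zero (by rw [hcard]; exact Nat.card_pos.ne')
  have := Fintype.ofFinite (Abelianization A →* Kˣ)
  let ab : A →* Abelianization A := Abelianization.of
  have hker : ∀ t : A, ab t = 1 → ρ t * π = π := by
    intro t ht
    have ht' : t ∈ commutator A := (QuotientGroup.eq_one_iff _).mp ht
    let D : Subgroup A :=
      { carrier := {a | ρ a * π = π}
        one_mem' := by simp
        mul_mem' := by
          intro a b ha hb
          simp only [Set.mem_ofPred_eq, Subgroup.coe_mul, map_mul, mul_assoc] at *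
          rw [hb, ha]
        inv_mem' := by
          intro a ha
          simp only [Set.mem_ofPred_eq] at *
          conv_lhs => rw [← ha]
          rw [Subgroup.coe_inv, ← mul_assoc, rho_inv, one_mul] }
    have : commutator A ≤ D := by
      rw [commutator_def, Subgroup.commutator_le]
      intro a _ b _
      exact hab a a.2 b b.2
    exact this ht'
  have h1 : ∀ χ : Abelianization A →* Kˣ,
      ∑ t : A, ((χ (ab t⁻¹) : Kˣ) : K) • (y * (ρ t * π)) = 0 := by
    intro χ
    let c : T → K := fun t => if ht : t ∈ A then ((χ (ab ⟨t, ht⟩) : Kˣ) : K) else 0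
    have hcA : ∀ t : A, c t = χ (ab t) := fun t => by simp [c]
    have hc : IsChar A c := by
      refine ⟨?_, ?_⟩
      · have := hcA 1; simpa using this
      · intro a ha b hb
        have h1 := hcA ⟨a, ha⟩
        have h2 := hcA ⟨b, hb⟩
        have h3 := hcA (⟨a, ha⟩ * ⟨b, hb⟩)
        rw [map_mul, map_mul, Units.val_mul, ← h1, ← h2] at h3
        exact h3
    have := h c hc
    rw [idem, smul_mul_assoc, mul_smul_comm] at this
    have := (smul_eq_zero.mp this).resolve_left (inv_ne_zero hA)
    rw [← this, Finset.sum_mul, Finset.mul_sum]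
    refine Finset.sum_congr rfl fun t _ => ?_
    rw [← hcA, smul_mul_assoc, mul_smul_comm, Subgroup.coe_inv]
  have h2 : ∑ t : A, (∑ χ : Abelianization A →* Kˣ, ((χ (ab t⁻¹) : Kˣ) : K)) • (y * (ρ t * π)) = 0 := by
    simp only [Finset.sum_smul]
    rw [Finset.sum_comm]
    exact Finset.sum_eq_zero fun χ _ => h1 χ
  have h3 : ∀ b : Abelianization A, b ≠ 1 →
      ∑ χ : Abelianization A →* Kˣ, ((χ b : Kˣ) : K) = 0 := by
    intro b hb
    obtain ⟨φ, hφ⟩ := CommGroup.exists_apply_ne_one_of_hasEnoughRootsOfUnity (Abelianization A) K hb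
    have e : ∑ χ : Abelianization A →* Kˣ, ((χ b : Kˣ) : K) =
        ((φ b : Kˣ) : K) * ∑ χ : Abelianization A →* Kˣ, ((χ b : Kˣ) : K) := by
      conv_lhs => rw [← Equiv.sum_comp (Equiv.mulLeft φ)]
      rw [Finset.mul_sum]
      simp
    have : (((φ b : Kˣ) : K) - 1) * ∑ χ : Abelianization A →* Kˣ, ((χ b : Kˣ) : K) = 0 := by
      rw [sub_mul, one_mul, ← e, sub_self]
    refine (mul_eq_zero.mp this).resolve_left (sub_ne_zero.mpr ?_)
    simpa using hφ
  have h4 : ∀ t : A, (∑ χ : Abelianization A →* Kˣ, ((χ (ab t⁻¹) : Kˣ) : K)) • (y * (ρ t * π)) =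
      if ab t = 1 then (Nat.card (Abelianization A) : K) • (y * π) else 0 := by
    intro t
    split_ifs with ht
    · rw [hker t ht, map_inv, ht]
      rw [← hcard]
      simp [Nat.card_eq_fintype_card]
    · rw [h3 _ (by simpa using ht), zero_smul]
  rw [Finset.sum_congr rfl fun t _ => h4 t, ← Finset.sum_filter, Finset.sum_const,
    ← Nat.cast_smul_eq_nsmul K] at h2
  have h5 : (((Finset.univ.filter fun t : A => ab t = 1).card : ℕ) : K) ≠ 0 := by
    refine cast_ne_zero_of_dvd hA ?_
    have : (Finset.univ.filter fun t : A => ab t = 1).card = Nat.card ab.ker := by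
      rw [Nat.card_eq_fintype_card, Fintype.card_subtype]
      congr
    rw [this]
    exact Subgroup.card_subgroup_dvd_card _
  exact (smul_eq_zero.mp ((smul_eq_zero.mp h2).resolve_left h5)).resolve_left hB

end

/-- Elements of `P` whose commutators with elements of `M` lie in `N`. -/
def commInto {T : Type*} [Group T] (P N : Subgroup T) (M : Set T)
    (hN : ∀ p ∈ P, ∀ n ∈ N, p * n * p⁻¹ ∈ N) : Subgroup T where
  carrier := {g | g ∈ P ∧ ∀ m ∈ M, g * m * g⁻¹ * m⁻¹ ∈ N}
  one_mem' := ⟨P.one_mem, fun m _ => by simp⟩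
  mul_mem' := by
    rintro g h ⟨hg, hg'⟩ ⟨hh, hh'⟩
    refine ⟨P.mul_mem hg hh, fun m hm => ?_⟩
    have := N.mul_mem (hN g hg _ (hh' m hm)) (hg' m hm)
    convert this using 1; group
  inv_mem' := by
    rintro g ⟨hg, hg'⟩
    refine ⟨P.inv_mem hg, fun m hm => ?_⟩
    have := hN _ (P.inv_mem hg) _ (N.inv_mem (hg' m hm))
    convert this using 1; group

theorem commInto_norm {T : Type*} [Group T] {P N : Subgroup T} {M : Set T}
    {hN : ∀ p ∈ P, ∀ n ∈ N, p * n * p⁻¹ ∈ N} {s : T} (h1 : ∀ p ∈ P, s * p * s⁻¹ ∈ P)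
    (h2 : ∀ p ∈ N, s * p * s⁻¹ ∈ N) (h3 : ∀ m ∈ M, s⁻¹ * m * s ∈ M) :
    ∀ a ∈ commInto P N M hN, s * a * s⁻¹ ∈ commInto P N M hN := by
  rintro a ⟨ha, ha'⟩
  refine ⟨h1 a ha, fun m hm => ?_⟩
  have := h2 _ (ha' _ (h3 m hm))
  convert this using 1; group

theorem exists_last {T : Type*} [Group T] [Finite T] {q : ℕ} (hq : q.Prime) {P Z N : Subgroup T}
    (hP : IsPGroup q P) (hNP : N ≤ P) (hN : ∀ p ∈ P, ∀ n ∈ N, p * n * p⁻¹ ∈ N)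
    {x : T} (hx : x ∈ N) (hxZ : x ∉ Z) :
    ∃ g ∈ N, g ∉ Z ∧ ∀ p ∈ P, g * p * g⁻¹ * p⁻¹ ∈ Z := by
  by_contra hcon
  push Not at hcon
  have := Fact.mk hq
  have hnil : Group.IsNilpotent P := hP.isNilpotent
  obtain ⟨n, hn⟩ := Subgroup.nilpotent_iff_lowerCentralSeries.mp hnil
  have key : ∀ n : ℕ, ∃ g : P, (g : T) ∈ N ∧ (g : T) ∉ Z ∧
      g ∈ Subgroup.lowerCentralSeries (⊤ : Subgroup P) n := by
    intro n
    induction n with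
    | zero => exact ⟨⟨x, hNP hx⟩, hx, hxZ, by simp⟩
    | succ n ih =>
      obtain ⟨g, hg, hgZ, hgn⟩ := ih
      obtain ⟨p, hp, hpZ⟩ := hcon g hg hgZ
      refine ⟨g * ⟨p, hp⟩ * g⁻¹ * (⟨p, hp⟩ : P)⁻¹, ?_, hpZ, ?_⟩
      · have := N.mul_mem hg (hN p hp _ (N.inv_mem hg))
        simpa [mul_assoc] using this
      · rw [Subgroup.lowerCentralSeries_succ]
        exact Subgroup.commutator_mem_commutator hgn (Subgroup.mem_top _)
  obtain ⟨g, -, hgZ, hgn⟩ := key n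
  rw [hn, Subgroup.mem_bot] at hgn
  apply hgZ; rw [hgn]; exact Z.one_mem

section
variable {T E K : Type*} [Group T] [Fintype T] [Field K] [Ring E] [Algebra K E]
    {ρ : T →* E} {S : Subgroup T} {π : E}

/-- Elements of `P` acting trivially on the block. -/
def actTriv (ρ : T →* E) (P : Subgroup T) (π : E) : Subgroup T where
  carrier := {g | g ∈ P ∧ ρ g * π = π}
  one_mem' := ⟨P.one_mem, by simp⟩
  mul_mem' := by
    rintro g h ⟨hg, hg'⟩ ⟨hh, hh'⟩
    exact ⟨P.mul_mem hg hh, by rw [map_mul, mul_assoc, hh', hg']⟩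
  inv_mem' := by
    rintro g ⟨hg, hg'⟩
    refine ⟨P.inv_mem hg, ?_⟩
    conv_lhs => rw [← hg']
    rw [← mul_assoc, rho_inv, one_mul]

variable (K) in
/-- Elements of `P` acting as scalars on the block. -/
def actScal (ρ : T →* E) (P : Subgroup T) (π : E) : Subgroup T where
  carrier := {g | g ∈ P ∧ ∃ c : K, ρ g * π = c • π}
  one_mem' := ⟨P.one_mem, 1, by simp⟩
  mul_mem' := by
    rintro g h ⟨hg, c, hg'⟩ ⟨hh, d, hh'⟩
    exact ⟨P.mul_mem hg hh, d * c, by rw [map_mul, mul_assoc, hh', mul_smul_comm, hg', mul_smul]⟩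
  inv_mem' := by
    rintro g ⟨hg, c, hg'⟩
    refine ⟨P.inv_mem hg, c⁻¹, ?_⟩
    have h1 : π = c • (ρ g⁻¹ * π) := by
      rw [← mul_smul_comm, ← hg', ← mul_assoc, rho_inv, one_mul]
    by_cases hc : c = 0
    · have h2 : π = 0 := by rw [h1, hc, zero_smul]
      rw [h2]; simp
    · conv_rhs => rw [h1]
      rw [smul_smul, inv_mul_cancel₀ hc, one_smul]

theorem conj_act (hb : Block ρ S π) {s g : T} (hs : s ∈ S) {c : K} (hg : ρ g * π = c • π) :
    ρ (s * g * s⁻¹) * π = c • π := by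
  rw [map_mul, map_mul, mul_assoc, hb.comm _ (S.inv_mem hs), mul_assoc, ← mul_assoc (ρ g), hg,
    smul_mul_assoc, mul_smul_comm, ← mul_assoc, hb.comm s hs, mul_assoc, rho_inv', mul_one]

theorem scal_comm (hb : Block ρ S π) {s g : T} (hs : s ∈ S) {c : K} (hg : ρ g * π = c • π) :
    ρ (s * g⁻¹ * s⁻¹ * g) * π = π := by
  rw [map_mul, mul_assoc, hg, mul_smul_comm, map_mul, map_mul, mul_assoc,
    hb.comm _ (S.inv_mem hs), mul_assoc, ← mul_assoc (ρ g⁻¹), ← mul_smul_comm, ← smul_mul_assoc,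
    ← mul_smul_comm, ← hg, ← mul_assoc (ρ g⁻¹), rho_inv, one_mul,
    ← mul_assoc, hb.comm s hs, mul_assoc, rho_inv', mul_one]

theorem sg_comm {A : Subgroup T} {y : E} (h : ∀ a ∈ A, y * ρ a = ρ a * y) :
    y * sg ρ A = sg ρ A * y := by
  classical
  rw [sg, Finset.mul_sum, Finset.sum_mul]
  refine Finset.sum_congr rfl fun t _ => ?_
  split_ifs with ht
  · exact h t ht
  · simp

theorem endgame {q : ℕ} (hq : q.Prime) (Q H : Subgroup T) (hQn : Q.Normal) (hQp : IsPGroup q Q)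
    (hcop : q.Coprime (Nat.card H)) (hb : Block ρ S π)
    (hw : sg ρ (H ⊓ S) * π ≠ 0) {x : T} (hxQ : x ∈ Q) (hxS : x ∈ S)
    (hxH : ∀ h ∈ H, h * x * h⁻¹ = x) (hxw : ρ x * (sg ρ (H ⊓ S) * π) = sg ρ (H ⊓ S) * π)
    (hsc : ∀ A : Subgroup T, A ≤ Q ⊓ S → (∀ s ∈ S, ∀ a ∈ A, s * a * s⁻¹ ∈ A) →
      (∀ a ∈ A, ∀ b ∈ A, ρ (a * b * a⁻¹ * b⁻¹) * π = π) →
      ∀ a ∈ A, ∃ c : K, ρ a * π = c • π) : ρ x * π = π := by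
  classical
  set P := Q ⊓ S with hPdef
  have hxP : x ∈ P := ⟨hxQ, hxS⟩
  have hPp : IsPGroup q P := hQp.to_le inf_le_left
  have hPS : ∀ s ∈ S, ∀ p ∈ P, s * p * s⁻¹ ∈ P := fun s hs p hp =>
    ⟨hQn.conj_mem p hp.1 s, S.mul_mem (S.mul_mem hs hp.2) (S.inv_mem hs)⟩
  set D := actTriv ρ P π with hD
  set Z := actScal K ρ P π with hZ
  have hDS : ∀ s ∈ S, ∀ p ∈ D, s * p * s⁻¹ ∈ D := by
    rintro s hs p ⟨hp, hp'⟩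
    refine ⟨hPS s hs p hp, ?_⟩
    have := conj_act (K := K) hb hs (c := 1) (g := p) (by rw [hp', one_smul])
    rwa [one_smul] at this
  have hZS : ∀ s ∈ S, ∀ p ∈ Z, s * p * s⁻¹ ∈ Z := by
    rintro s hs p ⟨hp, c, hp'⟩
    exact ⟨hPS s hs p hp, c, conj_act hb hs hp'⟩
  have hPleS : P ≤ S := inf_le_right
  set C := commInto P Z (P : Set T) (fun p hp => hZS p hp.2) with hC
  have hinv : ∀ s ∈ S, ∀ M : Subgroup T, (∀ s ∈ S, ∀ m ∈ M, s * m * s⁻¹ ∈ M) → ∀ m ∈ M,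
      s⁻¹ * m * s ∈ M := by
    intro s hs M hM m hm
    have := hM s⁻¹ (S.inv_mem hs) m hm
    rwa [inv_inv] at this
  have hCS : ∀ s ∈ S, ∀ p ∈ C, s * p * s⁻¹ ∈ C := fun s hs =>
    commInto_norm (hPS s hs) (hZS s hs) (hinv s hs P hPS)
  have hCP : C ≤ P := fun g hg => hg.1
  set w := sg ρ (H ⊓ S) * π with hwdef
  have hσπ : π * sg ρ (H ⊓ S) = sg ρ (H ⊓ S) * π := sg_comm fun a ha => (hb.comm a ha.2).symm
  have hπw : π * w = w := by
    rw [hwdef, ← mul_assoc, hσπ, mul_assoc, hb.idem]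
  have hyw : ∀ y ∈ S, (∀ h ∈ H ⊓ S, y * h = h * y) → ρ y * w = w * ρ y := by
    intro y hy h
    have h1 : ρ y * sg ρ (H ⊓ S) = sg ρ (H ⊓ S) * ρ y := sg_comm fun a ha => by
      rw [← map_mul, h a ha, map_mul]
    rw [hwdef, ← mul_assoc, h1, mul_assoc, mul_assoc, hb.comm y hy]
  have hscalw : ∀ g : T, ∀ c : K, ρ g * π = c • π → ρ g * w = c • w := by
    intro g c h
    rw [← hπw, ← mul_assoc, h, smul_mul_assoc]
  by_cases hxZ : x ∈ Z
  · obtain ⟨-, c, hc⟩ := hxZ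
    have h1 := hscalw x c hc
    rw [hxw] at h1
    have h2 : (1 - c) • w = 0 := by rw [sub_smul, one_smul, ← h1, sub_self]
    have h3 : 1 - c = 0 := (smul_eq_zero.mp h2).resolve_right hw
    rw [hc, ← sub_eq_zero.mp h3, one_smul]
  exfalso
  have hex : ∃ c ∈ C, c * x * c⁻¹ * x⁻¹ ∉ D := by
    by_contra hcon
    push Not at hcon
    set N := commInto P D (C : Set T) (fun p hp => hDS p hp.2) with hNdef
    have hxN : x ∈ N := by
      refine ⟨hxP, fun c hc => ?_⟩
      have := D.inv_mem (hcon c hc)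
      convert this using 1; group
    have hNS : ∀ s ∈ S, ∀ p ∈ N, s * p * s⁻¹ ∈ N := fun s hs =>
      commInto_norm (hPS s hs) (hDS s hs) (hinv s hs C hCS)
    obtain ⟨g, hgN, hgZ, hg⟩ := exists_last hq hPp (N := N) (fun g hg => hg.1)
      (fun p hp => hNS p hp.2) hxN hxZ
    have hgC : g ∈ C := ⟨hgN.1, hg⟩
    have := hsc (N ⊓ C) (fun a ha => ha.1.1)
      (fun s hs a ha => ⟨hNS s hs a ha.1, hCS s hs a ha.2⟩)
      (fun a ha b hb => (ha.1.2 b hb.2).2) g ⟨hgN, hgC⟩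
    exact hgZ ⟨hgN.1, this⟩
  obtain ⟨c, hcC, hcD⟩ := hex
  have hCleS : ∀ g ∈ C, g ∈ S := fun g hg => hPleS (hCP hg)
  set M := commInto C D ({x} : Set T) (fun p hp => hDS p (hCleS p hp)) with hM
  have hMC : M ≤ C := fun g hg => hg.1
  have hMH : ∀ s ∈ H ⊓ S, ∀ m ∈ M, s * m * s⁻¹ ∈ M := by
    intro s hs
    refine commInto_norm (hCS s hs.2) (hDS s hs.2) ?_
    rintro m hm
    have := hxH s⁻¹ (H.inv_mem hs.1)
    rw [Set.mem_singleton_iff] at hm ⊢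
    rw [hm]; rwa [inv_inv] at this
  have hcu : ∃ μ : K, ρ (c * x * c⁻¹ * x⁻¹) * π = μ • π := (hcC.2 x hxP).2
  obtain ⟨μ, hμ⟩ := hcu
  have hchc : ∀ h ∈ H ⊓ S, c * h * c⁻¹ * h⁻¹ ∈ M := by
    intro h hh
    have hcm : c * h * c⁻¹ * h⁻¹ ∈ C := by
      have := C.mul_mem hcC (hCS h hh.2 _ (C.inv_mem hcC))
      convert this using 1; group
    refine ⟨hcm, fun m hm => ?_⟩
    rw [Set.mem_singleton_iff] at hm
    rw [hm]
    refine ⟨?_, ?_⟩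
    · have hd := hCP hcm
      have := P.mul_mem hd (P.mul_mem hxP (P.mul_mem (P.inv_mem hd) (P.inv_mem hxP)))
      convert this using 1; group
    · have hS : c * h * c⁻¹ ∈ S :=
        S.mul_mem (S.mul_mem (hCleS c hcC) hh.2) (S.inv_mem (hCleS c hcC))
      have := scal_comm hb hS hμ
      convert this using 3
      have e1 : x⁻¹ * h⁻¹ * x = h⁻¹ := by
        have := hxH h hh.1
        have e2 : h * x = x * h := by rw [mul_inv_eq_iff_eq_mul] at this; exact this
        rw [mul_assoc, inv_mul_eq_iff_eq_mul, inv_mul_eq_iff_eq_mul, ← mul_assoc, e2]; group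
      have e3 : h⁻¹ * x * h = x := by simpa using hxH h⁻¹ (H.inv_mem hh.1)
      calc c * h * c⁻¹ * h⁻¹ * x * (c * h * c⁻¹ * h⁻¹)⁻¹ * x⁻¹
          = c * h * c⁻¹ * (h⁻¹ * x * h) * c * h⁻¹ * c⁻¹ * x⁻¹ := by group
        _ = c * h * c⁻¹ * x * c * (x⁻¹ * h⁻¹ * x) * c⁻¹ * x⁻¹ := by rw [e1, e3]
        _ = _ := by group
  have hcardH : q.Coprime (Nat.card (H ⊓ S : Subgroup T)) :=
    hcop.coprime_dvd_right (Subgroup.card_dvd_of_le inf_le_left)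
  obtain ⟨m, hmM, hm⟩ := conj_compl hq _ M (H ⊓ S)
    ((H ⊓ S).map (MulAut.conj c).toMonoidHom) le_rfl
    (hPp.to_le (hMC.trans hCP)) hMH hcardH
    (by
      rw [Subgroup.card_map_of_injective (MulAut.conj c).injective]
      exact hcardH)
    (by
      rintro a ⟨h, hh, rfl⟩
      exact ⟨h, hh, hchc h hh⟩)
  set y := m * c with hy
  have hyC : y ∈ C := C.mul_mem (hMC hmM) hcC
  have hQH : ∀ t ∈ Q, t ∈ H → t = 1 := by
    intro t h1 h2
    have := Fact.mk hq
    obtain ⟨r, hr⟩ := hQp ⟨t, h1⟩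
    have h3 : t ^ q ^ r = 1 := by simpa using congrArg Subtype.val hr
    have h4 : orderOf t ∣ Nat.card H := Subgroup.orderOf_dvd_natCard H h2
    have h5 : orderOf t ∣ q ^ r := orderOf_dvd_of_pow_eq_one h3
    have h6 : Nat.Coprime (q ^ r) (Nat.card H) := hcop.pow_left r
    exact orderOf_eq_one_iff.mp (Nat.eq_one_of_dvd_coprimes h6 h5 h4)
  have hycomm : ∀ h ∈ H ⊓ S, y * h = h * y := by
    intro h hh
    have h1 : y * h * y⁻¹ ∈ H := by
      have h0 : m * (c * h * c⁻¹) * m⁻¹ ∈ H := (hm _ ⟨h, hh, rfl⟩).1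
      convert h0 using 1
      rw [hy]; group
    have h2 : y * h * y⁻¹ * h⁻¹ = 1 := by
      refine hQH _ ?_ (H.mul_mem h1 (H.inv_mem hh.1))
      have := Q.mul_mem (hCP hyC).1 (hQn.conj_mem _ (Q.inv_mem (hCP hyC).1) h)
      convert this using 1; group
    rw [mul_inv_eq_one, mul_inv_eq_iff_eq_mul] at h2
    exact h2
  obtain ⟨-, ν, hν⟩ := hyC.2 x hxP
  have hν1 : ν ≠ 1 := by
    rintro rfl
    have hyM : y ∈ M := by
      refine ⟨hyC, fun z hz => ?_⟩
      rw [Set.mem_singleton_iff] at hz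
      rw [hz]
      refine ⟨(hyC.2 x hxP).1, by rw [hν, one_smul]⟩
    have : c ∈ M := by
      have := M.mul_mem (M.inv_mem hmM) hyM
      rwa [hy, inv_mul_cancel_left] at this
    exact hcD (this.2 x rfl)
  have h1 := hyw y (hCleS y hyC) hycomm
  have h2 : ρ y * (ρ x * w) = ρ (y * x * y⁻¹ * x⁻¹) * (ρ x * (ρ y * w)) := by
    clear_value w
    rw [← mul_assoc, ← mul_assoc, ← mul_assoc, ← map_mul, ← map_mul, ← map_mul]
    congr 2; group
  rw [hxw, h1, ← mul_assoc (ρ x), hxw, ← mul_assoc, hscalw _ _ hν, smul_mul_assoc] at h2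
  have h3 : (1 - ν) • (w * ρ y) = 0 := by rw [sub_smul, one_smul, ← h2, sub_self]
  have h4 : w * ρ y = 0 :=
    (smul_eq_zero.mp h3).resolve_left (sub_ne_zero.mpr hν1.symm)
  apply hw
  calc w = w * ρ y * ρ y⁻¹ := by rw [mul_assoc, rho_inv', mul_one]
    _ = 0 := by rw [h4, zero_mul]

end

theorem mem_of_mul_mem {T : Type*} [Group T] [Finite T] {q : ℕ} {Q H S : Subgroup T}
    (hQp : IsPGroup q Q) (hcop : q.Coprime (Nat.card H)) {x h : T} (hx : x ∈ Q) (hh : h ∈ H)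
    (hc : h * x * h⁻¹ = x) (hS : x * h ∈ S) : x ∈ S := by
  obtain ⟨r, hr⟩ := hQp ⟨x, hx⟩
  have h3 : x ^ q ^ r = 1 := by simpa using congrArg Subtype.val hr
  have h4 : orderOf h ∣ Nat.card H := Subgroup.orderOf_dvd_natCard H hh
  have h5 : orderOf x ∣ q ^ r := orderOf_dvd_of_pow_eq_one h3
  have h6 : Nat.Coprime (q ^ r) (Nat.card H) := hcop.pow_left r
  have h7 : Nat.Coprime (orderOf x) (orderOf h) :=
    (h6.coprime_dvd_left h5).coprime_dvd_right h4
  obtain ⟨n, hn1, hn2⟩ := Nat.chineseRemainder h7 1 0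
  have hcm : Commute x h := by
    rw [mul_inv_eq_iff_eq_mul] at hc
    exact hc.symm
  have e1 : x ^ n = x := by
    rw [← pow_eq_pow_iff_modEq, pow_one] at hn1; exact hn1
  have e2 : h ^ n = 1 := by
    rw [← pow_eq_pow_iff_modEq, pow_zero] at hn2; exact hn2
  have := S.pow_mem hS n
  rwa [hcm.mul_pow, e1, e2, mul_one] at this

theorem main_alg {T E K : Type*} [Group T] [Fintype T] [Field K] [IsSepClosed K] [Ring E]
    [Algebra K E]
    (ρ : T →* E) (hT : (Nat.card T : K) ≠ 0)
    (Q F H : Subgroup T) (q : ℕ) (hq : q.Prime)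
    (hQn : Q.Normal) (hQp : IsPGroup q Q)
    (hFH_norm : ∀ h ∈ H, ∀ f ∈ F, h * f * h⁻¹ ∈ F)
    (hfrob : ∀ h ∈ H, h ≠ 1 → ∀ f ∈ F, h * f * h⁻¹ = f → f = 1)
    (hgen : Q ⊔ F ⊔ H = ⊤)
    (hcop : Nat.Coprime q (Nat.card ↥(F ⊔ H)))
    (hF : sg ρ F = 0) {x : T} (hxQ : x ∈ Q) (hxH : ∀ h ∈ H, h * x * h⁻¹ = x)
    (hx : ρ x * sg ρ H = sg ρ H) : ρ x = 1 := by
  classical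
  have hcH : q.Coprime (Nat.card H) :=
    hcop.coprime_dvd_right (Subgroup.card_dvd_of_le le_sup_right)
  have key : ∀ n : ℕ, ∀ (S : Subgroup T) (π : E), Block ρ S π →
      (Finset.univ.filter fun g => g ∈ S ∧ ¬ ∃ c : K, ρ g * π = c • π).card = n →
      ρ x * π = π := by
    intro n
    induction n using Nat.strong_induction_on with
    | _ n ih =>
    intro S π hb hn
    by_cases hπ : π = 0
    · rw [hπ, mul_zero]
    have hw : sg ρ (H ⊓ S) * π ≠ 0 := fun h0 => hπ
      (block_fix ρ hT Q F H q hq hQn hQp hFH_norm hfrob hgen hcop hF S π hb h0)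
    by_cases hsc : ∀ A : Subgroup T, A ≤ Q ⊓ S → (∀ s ∈ S, ∀ a ∈ A, s * a * s⁻¹ ∈ A) →
      (∀ a ∈ A, ∀ b ∈ A, ρ (a * b * a⁻¹ * b⁻¹) * π = π) →
      ∀ a ∈ A, ∃ c : K, ρ a * π = c • π
    · have hw2 : π * sg ρ H * π = sg ρ (H ⊓ S) * π := by
        rw [sg, sg, Finset.mul_sum, Finset.sum_mul, Finset.sum_mul]
        refine Finset.sum_congr rfl fun t _ => ?_
        by_cases h1 : t ∈ H
        · by_cases h2 : t ∈ S
          · simp only [h1, h2, Subgroup.mem_inf, and_self, if_true, hb.sandwich h2]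
          · simp only [h1, h2, Subgroup.mem_inf, and_false, if_true, if_false, hb.off t h2,
              zero_mul]
        · simp [h1]
      have hxS : x ∈ S := by
        by_contra hxS
        apply hw
        rw [← hw2, ← hx, sg, Finset.mul_sum, Finset.mul_sum, Finset.sum_mul]
        refine Finset.sum_eq_zero fun t _ => ?_
        split_ifs with ht
        · rw [← map_mul]
          exact hb.off _ fun hS => hxS (mem_of_mul_mem hQp hcH hxQ ht (hxH t ht) hS)
        · simp
      have hxw : ρ x * (sg ρ (H ⊓ S) * π) = sg ρ (H ⊓ S) * π := by
        rw [← hw2, ← mul_assoc, ← mul_assoc, hb.comm x hxS, mul_assoc π, hx]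
      exact endgame hq Q H hQn hQp hcH hb hw hxQ hxS hxH hxw hsc
    · push Not at hsc
      obtain ⟨A, hA, hAn, hAab, a, ha, hna⟩ := hsc
      have hAS : A ≤ S := hA.trans inf_le_right
      have := char_sum (ρ := ρ) (A := A) hT (π := π) (y := ρ x - 1) hAab (by
        intro c hc
        have hb' := block_refine hT hc hb hAS hAn
        rw [sub_mul, one_mul, sub_eq_zero]
        refine ih _ ?_ _ _ hb' rfl
        rw [← hn]
        apply Finset.card_lt_card
        rw [Finset.ssubset_iff_of_subset]
        · refine ⟨a, ?_, ?_⟩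
          · simp only [Finset.mem_filter, Finset.mem_univ, true_and]
            exact ⟨hAS ha, by push Not; exact hna⟩
          · simp only [Finset.mem_filter, Finset.mem_univ, true_and, not_and, not_not]
            intro _
            exact ⟨c a, by rw [← mul_assoc, idem_left hc ha, smul_mul_assoc]⟩
        · intro g
          simp only [Finset.mem_filter, Finset.mem_univ, true_and]
          rintro ⟨⟨hgS, hgc⟩, hg⟩
          refine ⟨hgS, fun ⟨d, hd⟩ => hg ⟨d, ?_⟩⟩
          have hcomm : idem ρ A c * π = π * idem ρ A c :=
            idem_comm fun a ha => hb.comm a (hAS ha)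
          rw [hcomm, ← mul_assoc, hd, smul_mul_assoc])
      rw [sub_mul, one_mul, sub_eq_zero] at this
      exact this
  have := key _ ⊤ 1 ⟨by simp, by simp, by simp⟩ rfl
  rwa [mul_one] at this

/-- Let `T = QFH` where `Q` is a normal `q`-subgroup and `FH` is a Frobenius subgroup
with kernel `F` and complement `H`, with `q` coprime to `|FH|`.  If `V` is a `k[T]`-module
with `char k ∤ |T|` and `C_V(F) = 0`, then an element of `C_Q(H)` acts trivially on
`C_V(H)` iff it acts trivially on all of `V`. -/
theorem ker_fixedQ_on_fixedV_eq_ker_on_V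
    (T : Type*) [Group T] [Finite T] (Q F H : Subgroup T) (q : ℕ) (hq : q.Prime)
    (hQn : Q.Normal) (hQp : IsPGroup q ↥Q)
    (hFH_norm : ∀ h ∈ H, ∀ f ∈ F, h * f * h⁻¹ ∈ F)
    (hF : F ≠ ⊥) (hH : H ≠ ⊥) (hFHtriv : F ⊓ H = ⊥)
    (hfrob : ∀ h ∈ H, h ≠ 1 → ∀ f ∈ F, h * f * h⁻¹ = f → f = 1)
    (hgen : Q ⊔ F ⊔ H = ⊤)
    (hcop : Nat.Coprime q (Nat.card ↥(F ⊔ H)))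
    (k : Type*) [Field k] (V : Type*) [AddCommGroup V] [Module k V]
    [DistribMulAction T V] [SMulCommClass T k V]
    (hchar : ¬ (ringChar k ∣ Nat.card T))
    (hCVF : ∀ v : V, (∀ f ∈ F, f • v = v) → v = 0) :
    ∀ x ∈ Q, (∀ h ∈ H, h * x * h⁻¹ = x) →
      ((∀ v : V, (∀ h ∈ H, h • v = v) → x • v = v) ↔ ∀ v : V, x • v = v) := by
  classical
  intro x hxQ hxH
  refine ⟨fun hx => ?_, fun h v _ => h v⟩
  have := Fintype.ofFinite T
  let ρ₀ : T →* Module.End k V := DistribMulAction.toModuleEnd k V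
  have hρ₀ : ∀ t v, ρ₀ t v = t • v := fun t v => rfl
  have hTk : (Nat.card T : k) ≠ 0 := fun h0 => hchar ((ringChar.spec k _).mp h0)
  have hinv : ∀ (A : Subgroup T) (v : V), ∀ a ∈ A, a • (sg ρ₀ A v) = sg ρ₀ A v := by
    intro A v a ha
    rw [sg_eq, LinearMap.sum_apply, Finset.smul_sum]
    conv_rhs => rw [← Equiv.sum_comp (Equiv.mulLeft (⟨a, ha⟩ : A))]
    refine Finset.sum_congr rfl fun t _ => ?_
    simp [hρ₀, mul_smul]
  let K := AlgebraicClosure k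
  let ι : Module.End k V →ₐ[k] TensorProduct k K (Module.End k V) :=
    Algebra.TensorProduct.includeRight
  have hι : Function.Injective ι :=
    Algebra.TensorProduct.includeRight_injective (algebraMap k K).injective
  let ρ : T →* TensorProduct k K (Module.End k V) := (ι : _ →* _).comp ρ₀
  have hρ : ∀ t, ρ t = ι (ρ₀ t) := fun t => rfl
  have hsg : ∀ A : Subgroup T, sg ρ A = ι (sg ρ₀ A) := by
    intro A
    rw [sg_eq, sg_eq, map_sum]
    rfl
  have hTK : (Nat.card T : K) ≠ 0 := by
    intro h0; apply hTk
    apply (algebraMap k K).injective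
    rw [map_natCast, map_zero, h0]
  have h1 : ρ x = 1 := by
    refine main_alg ρ hTK Q F H q hq hQn hQp hFH_norm hfrob hgen hcop ?_ hxQ hxH ?_
    · rw [hsg]
      have : sg ρ₀ F = 0 := LinearMap.ext fun v => hCVF _ fun f hf => hinv F v f hf
      rw [this, map_zero]
    · rw [hsg, hρ, ← map_mul]
      congr 1
      exact LinearMap.ext fun v => hx _ fun h hh => hinv H v h hh
  intro v
  rw [hρ, ← map_one ι] at h1
  have h2 := hι h1
  have h3 : ρ₀ x v = (1 : Module.End k V) v := by rw [h2]
  exact h3
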